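/- Let φ(x₁,…,xₙ) be a DQF(τ)-formula over a relational vocabulary τ. The following are equivalent: (1) φ is coherent; (2) φ is rewritable to a universal first-order sentence; (3) φ is first-order rewritable. -/

import Mathlib

/-! Core definitions: team semantics for dependence logic over a relational vocabulary. -/

/-- A structure for a relational vocabulary: `σ` is the type of relation symbols,
`ar` gives their arities, `A` is the universe. -/
structure DepStr (σ : Type) (ar : σ → ℕ) (A : Type) where
  rel : ∀ r : σ, (Fin (ar r) → A) → Prop

/-- Formulas of dependence logic (in negation normal form), with free variables
of type `V`; quantifiers extend the variable type by one fresh variable (`Option`). -/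
inductive DepFormula (σ : Type) (ar : σ → ℕ) : Type → Type 1 where
  | rel {V : Type} (r : σ) (ts : Fin (ar r) → V) : DepFormula σ ar V
  | nrel {V : Type} (r : σ) (ts : Fin (ar r) → V) : DepFormula σ ar V
  | eq {V : Type} (x y : V) : DepFormula σ ar V
  | neq {V : Type} (x y : V) : DepFormula σ ar V
  | dep {V : Type} (m : ℕ) (ys : Fin m → V) (z : V) : DepFormula σ ar V
  | and {V : Type} (φ ψ : DepFormula σ ar V) : DepFormula σ ar V
  | or {V : Type} (φ ψ : DepFormula σ ar V) : DepFormula σ ar V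
  | all {V : Type} (φ : DepFormula σ ar (Option V)) : DepFormula σ ar V
  | ex {V : Type} (φ : DepFormula σ ar (Option V)) : DepFormula σ ar V

/-- Team semantics: `DepSat M V φ T` says that the team `T` (a set of assignments
`V → A`) satisfies `φ` in the structure `M`. -/
def DepSat {σ : Type} {ar : σ → ℕ} {A : Type} (M : DepStr σ ar A) :
    (V : Type) → DepFormula σ ar V → Set (V → A) → Prop
  | _, .rel r ts, T => ∀ s ∈ T, M.rel r fun i => s (ts i)
  | _, .nrel r ts, T => ∀ s ∈ T, ¬ M.rel r fun i => s (ts i)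
  | _, .eq x y, T => ∀ s ∈ T, s x = s y
  | _, .neq x y, T => ∀ s ∈ T, s x ≠ s y
  | _, .dep _ ys z, T => ∀ s₁ ∈ T, ∀ s₂ ∈ T, (∀ i, s₁ (ys i) = s₂ (ys i)) → s₁ z = s₂ z
  | V, .and φ ψ, T => DepSat M V φ T ∧ DepSat M V ψ T
  | V, .or φ ψ, T => ∃ T₁ T₂, T = T₁ ∪ T₂ ∧ DepSat M V φ T₁ ∧ DepSat M V ψ T₂
  | V, .all φ, T => DepSat M (Option V) φ {s | (fun v => s (some v)) ∈ T}
  | V, .ex φ, T => ∃ f : (V → A) → A,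
      DepSat M (Option V) φ {s | ∃ t ∈ T, s = fun o => Option.elim o (f t) t}

/-- The `∃`-free (universal) fragment `∀D`. -/
def DepFormula.noEx {σ : Type} {ar : σ → ℕ} : (V : Type) → DepFormula σ ar V → Prop
  | _, .ex _ => False
  | V, .all φ => DepFormula.noEx (Option V) φ
  | V, .and φ ψ => DepFormula.noEx V φ ∧ DepFormula.noEx V ψ
  | V, .or φ ψ => DepFormula.noEx V φ ∧ DepFormula.noEx V ψ
  | _, _ => True

/-- The quantifier-free fragment `DQF`. -/
def DepFormula.isQF {σ : Type} {ar : σ → ℕ} : (V : Type) → DepFormula σ ar V → Prop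
  | _, .ex _ => False
  | _, .all _ => False
  | V, .and φ ψ => DepFormula.isQF V φ ∧ DepFormula.isQF V ψ
  | V, .or φ ψ => DepFormula.isQF V φ ∧ DepFormula.isQF V ψ
  | _, _ => True

/-- The dependence-atom-free (first-order) fragment. -/
def DepFormula.noDep {σ : Type} {ar : σ → ℕ} : (V : Type) → DepFormula σ ar V → Prop
  | _, .dep _ _ _ => False
  | V, .and φ ψ => DepFormula.noDep V φ ∧ DepFormula.noDep V ψ
  | V, .or φ ψ => DepFormula.noDep V φ ∧ DepFormula.noDep V ψ
  | V, .all φ => DepFormula.noDep (Option V) φ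
  | V, .ex φ => DepFormula.noDep (Option V) φ
  | _, _ => True

/-- Induced substructure on a subset `B` of the universe (relational vocabulary). -/
def DepStr.sub {σ : Type} {ar : σ → ℕ} {A : Type} (M : DepStr σ ar A) (B : Set A) :
    DepStr σ ar B :=
  ⟨fun r v => M.rel r fun i => (v i : A)⟩

/-- Restriction `T ↾ B` of a team to assignments taking values in `B`. -/
def teamRestrict {V A : Type} (T : Set (V → A)) (B : Set A) : Set (V → B) :=
  {t | (fun v => (t v : A)) ∈ T}


/-- First-order formulas over a relational vocabulary. -/
inductive FOForm (σ : Type) (ar : σ → ℕ) : Type → Type 1 where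
  | rel {V : Type} (r : σ) (ts : Fin (ar r) → V) : FOForm σ ar V
  | eq {V : Type} (x y : V) : FOForm σ ar V
  | not {V : Type} (φ : FOForm σ ar V) : FOForm σ ar V
  | and {V : Type} (φ ψ : FOForm σ ar V) : FOForm σ ar V
  | or {V : Type} (φ ψ : FOForm σ ar V) : FOForm σ ar V
  | all {V : Type} (φ : FOForm σ ar (Option V)) : FOForm σ ar V
  | ex {V : Type} (φ : FOForm σ ar (Option V)) : FOForm σ ar V

/-- Tarskian satisfaction of a first-order formula by a single assignment. -/
def FOSat {σ : Type} {ar : σ → ℕ} {A : Type} (M : DepStr σ ar A) :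
    (V : Type) → FOForm σ ar V → (V → A) → Prop
  | _, .rel r ts, s => M.rel r fun i => s (ts i)
  | _, .eq x y, s => s x = s y
  | V, .not φ, s => ¬ FOSat M V φ s
  | V, .and φ ψ, s => FOSat M V φ s ∧ FOSat M V ψ s
  | V, .or φ ψ, s => FOSat M V φ s ∨ FOSat M V ψ s
  | V, .all φ, s => ∀ a : A, FOSat M (Option V) φ (fun o => Option.elim o a s)
  | V, .ex φ, s => ∃ a : A, FOSat M (Option V) φ (fun o => Option.elim o a s)

/-- A first-order sentence (no free variables) is true in `M`. -/
def FOTrue {σ : Type} {ar : σ → ℕ} {A : Type} (M : DepStr σ ar A)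
    (φ : FOForm σ ar Empty) : Prop :=
  FOSat M Empty φ (fun e => e.elim)

/-- Quantifier-free first-order formulas. -/
def FOForm.isQF {σ : Type} {ar : σ → ℕ} : (V : Type) → FOForm σ ar V → Prop
  | _, .all _ => False
  | _, .ex _ => False
  | V, .not φ => FOForm.isQF V φ
  | V, .and φ ψ => FOForm.isQF V φ ∧ FOForm.isQF V ψ
  | V, .or φ ψ => FOForm.isQF V φ ∧ FOForm.isQF V ψ
  | _, _ => True

/-- Universal first-order formulas: a block of `∀` followed by a quantifier-free formula. -/
inductive FOForm.IsUniversal {σ : Type} {ar : σ → ℕ} : {V : Type} → FOForm σ ar V → Prop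
  | of_qf {V : Type} (φ : FOForm σ ar V) : FOForm.isQF V φ → FOForm.IsUniversal φ
  | all {V : Type} (φ : FOForm σ ar (Option V)) :
      FOForm.IsUniversal φ → FOForm.IsUniversal (.all φ)

/-- `OptIter l V` adds `l` fresh variables to the variable type `V`. -/
def OptIter : ℕ → Type → Type
  | 0, V => V
  | l+1, V => Option (OptIter l V)

/-- The embedding of the old variables into `OptIter l V`. -/
def optEmbed : (l : ℕ) → {V : Type} → V → OptIter l V
  | 0, _, v => v
  | l+1, _, v => some (optEmbed l v)

/-- Prefix a first-order formula with `l` universal quantifiers. -/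
def FOForm.allIter {σ : Type} {ar : σ → ℕ} :
    (l : ℕ) → {V : Type} → FOForm σ ar (OptIter l V) → FOForm σ ar V
  | 0, _, φ => φ
  | l+1, _, φ => FOForm.allIter l (.all φ)

/-- Prefix a dependence formula with `l` universal quantifiers. -/
def DepFormula.allIter {σ : Type} {ar : σ → ℕ} :
    (l : ℕ) → {V : Type} → DepFormula σ ar (OptIter l V) → DepFormula σ ar V
  | 0, _, φ => φ
  | l+1, _, φ => DepFormula.allIter l (.all φ)

/-- The iterated duplicate team `T⟨y⃗ ↦ A⟩`: all extensions of members of `T`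
to the `l` new variables. -/
def dupIter {A : Type} (l : ℕ) {V : Type} (T : Set (V → A)) : Set (OptIter l V → A) :=
  {s | (fun v => s (optEmbed l v)) ∈ T}

/-- The vocabulary `τ ∪ {R}` with `R` a fresh `n`-ary relation symbol. -/
def exAr {σ : Type} (ar : σ → ℕ) (n : ℕ) : σ ⊕ Unit → ℕ :=
  Sum.elim ar fun _ => n

/-- The expansion `(A, Rel(T))` of a structure by a team, interpreting
the fresh symbol `R` as the `n`-ary relation determined by the team `T`. -/
def expandR {σ : Type} {ar : σ → ℕ} {A : Type} {n : ℕ}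
    (M : DepStr σ ar A) (T : Set (Fin n → A)) : DepStr (σ ⊕ Unit) (exAr ar n) A :=
  ⟨fun r => match r with
    | .inl r => M.rel r
    | .inr _ => fun v => v ∈ T⟩

/-- `ψ` rewrites the dependence formula `φ(x₁,…,xₙ)`:  `A ⊨_T φ  ↔  (A, Rel(T)) ⊨ ψ`. -/
def Rewrites {σ : Type} {ar : σ → ℕ} {n : ℕ}
    (ψ : FOForm (σ ⊕ Unit) (exAr ar n) Empty) (φ : DepFormula σ ar (Fin n)) : Prop :=
  ∀ (A : Type) [Nonempty A] (M : DepStr σ ar A) (T : Set (Fin n → A)),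
    DepSat M (Fin n) φ T ↔ FOTrue (expandR M T) ψ

/-- `φ` is first-order rewritable. -/
def FORewritable {σ : Type} {ar : σ → ℕ} {n : ℕ} (φ : DepFormula σ ar (Fin n)) : Prop :=
  ∃ ψ : FOForm (σ ⊕ Unit) (exAr ar n) Empty, Rewrites ψ φ

/-- `φ` is rewritable to a universal first-order sentence. -/
def UnivRewritable {σ : Type} {ar : σ → ℕ} {n : ℕ} (φ : DepFormula σ ar (Fin n)) : Prop :=
  ∃ ψ : FOForm (σ ⊕ Unit) (exAr ar n) Empty, ψ.IsUniversal ∧ Rewrites ψ φ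

/-- `φ` is `k`-coherent: a team satisfies `φ` iff all its subteams with at
most `k` elements do. -/
def KCoherent {σ : Type} {ar : σ → ℕ} {V : Type} (k : ℕ) (φ : DepFormula σ ar V) : Prop :=
  ∀ (A : Type) [Nonempty A] (M : DepStr σ ar A) (T : Set (V → A)),
    DepSat M V φ T ↔ ∀ S ⊆ T, S.Finite → S.ncard ≤ k → DepSat M V φ S

/-- `φ` is coherent: `k`-coherent for some `k ≥ 1`. -/
def Coherent {σ : Type} {ar : σ → ℕ} {V : Type} (φ : DepFormula σ ar V) : Prop :=
  ∃ k : ℕ, 1 ≤ k ∧ KCoherent k φ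

/-- `φ` is `k`-coherent in the finite. -/
def KCoherentFin {σ : Type} {ar : σ → ℕ} {V : Type} (k : ℕ) (φ : DepFormula σ ar V) : Prop :=
  ∀ (A : Type) [Nonempty A] [Finite A] (M : DepStr σ ar A) (T : Set (V → A)),
    DepSat M V φ T ↔ ∀ S ⊆ T, S.Finite → S.ncard ≤ k → DepSat M V φ S

/-- Strong `k`-coherence of `∀y₁…∀y_l β` (with `β` quantifier-free): a team `T`
satisfies `∀y⃗ β` iff every at-most-`k`-element subteam of the duplicated team
`T⟨y⃗ ↦ A⟩` satisfies `β`. -/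
def StronglyKCoherent {σ : Type} {ar : σ → ℕ} (k : ℕ) (n l : ℕ)
    (β : DepFormula σ ar (OptIter l (Fin n))) : Prop :=
  ∀ (A : Type) [Nonempty A] (M : DepStr σ ar A) (T : Set (Fin n → A)),
    DepSat M (Fin n) (DepFormula.allIter l β) T ↔
      ∀ S ⊆ dupIter l T, S.Finite → S.ncard ≤ k → DepSat M (OptIter l (Fin n)) β S

/-- Strong `k`-coherence in the finite. -/
def StronglyKCoherentFin {σ : Type} {ar : σ → ℕ} (k : ℕ) (n l : ℕ)
    (β : DepFormula σ ar (OptIter l (Fin n))) : Prop :=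
  ∀ (A : Type) [Nonempty A] [Finite A] (M : DepStr σ ar A) (T : Set (Fin n → A)),
    DepSat M (Fin n) (DepFormula.allIter l β) T ↔
      ∀ S ⊆ dupIter l T, S.Finite → S.ncard ≤ k → DepSat M (OptIter l (Fin n)) β S

theorem qf_mono {σ : Type} {ar : σ → ℕ} {A : Type} (M : DepStr σ ar A) {V : Type}
    (φ : DepFormula σ ar V) : DepFormula.isQF V φ → ∀ (S T : Set (V → A)), S ⊆ T →
      DepSat M V φ T → DepSat M V φ S := by
  induction φ with
  | rel r ts => intro _ S T h hT s hs; exact hT s (h hs)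
  | nrel r ts => intro _ S T h hT s hs; exact hT s (h hs)
  | eq x y => intro _ S T h hT s hs; exact hT s (h hs)
  | neq x y => intro _ S T h hT s hs; exact hT s (h hs)
  | dep m ys z => intro _ S T h hT s hs s' hs'; exact hT s (h hs) s' (h hs')
  | and φ ψ ih1 ih2 =>
    intro q S T h hT
    exact ⟨ih1 q.1 S T h hT.1, ih2 q.2 S T h hT.2⟩
  | or φ ψ ih1 ih2 =>
    rintro q S T h ⟨T₁, T₂, rfl, h1, h2⟩
    refine ⟨S ∩ T₁, S ∩ T₂, ?_, ih1 q.1 _ _ Set.inter_subset_right h1,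
      ih2 q.2 _ _ Set.inter_subset_right h2⟩
    rw [← Set.inter_union_distrib_left, Set.inter_eq_left.2 h]
  | all φ ih => intro q; exact q.elim
  | ex φ ih => intro q; exact q.elim

theorem qf_empty {σ : Type} {ar : σ → ℕ} {A : Type} (M : DepStr σ ar A) {V : Type}
    (φ : DepFormula σ ar V) : DepFormula.isQF V φ → DepSat M V φ ∅ := by
  induction φ with
  | rel r ts => intro _ s hs; exact hs.elim
  | nrel r ts => intro _ s hs; exact hs.elim
  | eq x y => intro _ s hs; exact hs.elim
  | neq x y => intro _ s hs; exact hs.elim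
  | dep m ys z => intro _ s hs; exact hs.elim
  | and φ ψ ih1 ih2 => intro q; exact ⟨ih1 q.1, ih2 q.2⟩
  | or φ ψ ih1 ih2 => intro q; exact ⟨∅, ∅, by simp, ih1 q.1, ih2 q.2⟩
  | all φ ih => intro q; exact q.elim
  | ex φ ih => intro q; exact q.elim

/-- Compactness: a team satisfies a quantifier-free formula if all finite subteams do. -/
theorem qf_compact {σ : Type} {ar : σ → ℕ} {A : Type} (M : DepStr σ ar A) {V : Type}
    (φ : DepFormula σ ar V) : DepFormula.isQF V φ → ∀ (T : Set (V → A)),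
      (∀ S : Finset (V → A), (S : Set (V → A)) ⊆ T → DepSat M V φ S) → DepSat M V φ T := by
  classical
  induction φ with
  | rel r ts => intro _ T h s hs; exact h {s} (by simpa using hs) s (by simp)
  | nrel r ts => intro _ T h s hs; exact h {s} (by simpa using hs) s (by simp)
  | eq x y => intro _ T h s hs; exact h {s} (by simpa using hs) s (by simp)
  | neq x y => intro _ T h s hs; exact h {s} (by simpa using hs) s (by simp)
  | dep m ys z =>
    intro _ T h s hs s' hs'
    exact h {s, s'} (by simp [Set.insert_subset_iff, hs, hs']) s (by simp) s' (by simp)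
  | and φ ψ ih1 ih2 =>
    intro q T h
    exact ⟨ih1 q.1 T fun S hS => (h S hS).1, ih2 q.2 T fun S hS => (h S hS).2⟩
  | or φ ψ ih1 ih2 =>
    intro q T h
    have h' : ∀ S : Finset T, ∃ T₁ T₂ : Set _,
        Subtype.val '' (S : Set T) = T₁ ∪ T₂ ∧ DepSat M _ φ T₁ ∧ DepSat M _ ψ T₂ := by
      intro S
      have := h (S.image Subtype.val) (by intro x; simp; tauto)
      rw [Finset.coe_image] at this
      exact this
    choose P Q hPQ hP hQ using h'
    let U : Ultrafilter (Finset T) := Ultrafilter.of Filter.atTop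
    have hU : (U : Filter (Finset T)) ≤ Filter.atTop := Ultrafilter.of_le _
    refine ⟨{s | s ∈ T ∧ ∀ᶠ S in (U : Filter _), s ∈ P S},
      {s | s ∈ T ∧ ∀ᶠ S in (U : Filter _), s ∈ Q S}, ?_, ?_, ?_⟩
    · ext s
      constructor
      · intro hs
        have : ∀ᶠ S in (U : Filter (Finset T)), s ∈ P S ∨ s ∈ Q S := by
          have h1 : ∀ᶠ S in (U : Filter (Finset T)), {⟨s, hs⟩} ≤ S :=
            hU (Filter.eventually_ge_atTop _)
          filter_upwards [h1] with S hS
          have : s ∈ Subtype.val '' (S : Set T) := ⟨⟨s, hs⟩, hS (by simp), rfl⟩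
          rw [hPQ] at this
          exact this
        rcases Ultrafilter.eventually_or.1 this with h | h
        · exact Or.inl ⟨hs, h⟩
        · exact Or.inr ⟨hs, h⟩
      · rintro (h | h) <;> exact h.1
    · refine ih1 q.1 _ fun S hS => ?_
      have : ∀ᶠ F in (U : Filter (Finset T)), ∀ s ∈ S, s ∈ P F :=
        (Filter.eventually_all_finset S).2 fun s hs => (hS hs).2
      obtain ⟨F, hF⟩ := this.exists
      exact qf_mono M φ q.1 _ _ hF (hP F)
    · refine ih2 q.2 _ fun S hS => ?_
      have : ∀ᶠ F in (U : Filter (Finset T)), ∀ s ∈ S, s ∈ Q F :=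
        (Filter.eventually_all_finset S).2 fun s hs => (hS hs).2
      obtain ⟨F, hF⟩ := this.exists
      exact qf_mono M ψ q.2 _ _ hF (hQ F)
  | all φ ih => intro q; exact q.elim
  | ex φ ih => intro q; exact q.elim

/-! Quantifier-free definability. -/

/-- `P` is definable by a quantifier-free formula. -/
def QFDef {σ : Type} (ar : σ → ℕ) (W : Type)
    (P : ∀ A : Type, DepStr σ ar A → (W → A) → Prop) : Prop :=
  ∃ θ : FOForm σ ar W, FOForm.isQF W θ ∧
    ∀ (A : Type) (M : DepStr σ ar A) (a : W → A), FOSat M W θ a ↔ P A M a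

theorem QFDef.neg {σ : Type} {ar : σ → ℕ} {W : Type}
    {P : ∀ A : Type, DepStr σ ar A → (W → A) → Prop} (h : QFDef ar W P) :
    QFDef ar W (fun A M a => ¬ P A M a) := by
  obtain ⟨θ, q, h⟩ := h
  exact ⟨.not θ, q, fun A M a => not_congr (h A M a)⟩

theorem QFDef.conj {σ : Type} {ar : σ → ℕ} {W : Type}
    {P Q : ∀ A : Type, DepStr σ ar A → (W → A) → Prop} (h : QFDef ar W P) (h' : QFDef ar W Q) :
    QFDef ar W (fun A M a => P A M a ∧ Q A M a) := by
  obtain ⟨θ, q, h⟩ := h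
  obtain ⟨θ', q', h'⟩ := h'
  exact ⟨.and θ θ', ⟨q, q'⟩, fun A M a => and_congr (h A M a) (h' A M a)⟩

theorem QFDef.congr {σ : Type} {ar : σ → ℕ} {W : Type}
    {P Q : ∀ A : Type, DepStr σ ar A → (W → A) → Prop} (h : QFDef ar W P)
    (hh : ∀ A M a, P A M a ↔ Q A M a) : QFDef ar W Q := by
  obtain ⟨θ, q, h⟩ := h
  exact ⟨θ, q, fun A M a => (h A M a).trans (hh A M a)⟩

theorem QFDef.imp {σ : Type} {ar : σ → ℕ} {W : Type}
    {P Q : ∀ A : Type, DepStr σ ar A → (W → A) → Prop} (h : QFDef ar W P) (h' : QFDef ar W Q) :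
    QFDef ar W (fun A M a => P A M a → Q A M a) :=
  (h.conj h'.neg).neg.congr fun A M a => by tauto

theorem QFDef.const {σ : Type} {ar : σ → ℕ} {W : Type} (w : W) (p : Prop) :
    QFDef ar W (fun _ _ _ => p) := by
  by_cases hp : p
  · exact ⟨.eq w w, trivial, fun A M a => by simp [FOSat, hp]⟩
  · exact ⟨.not (.eq w w), trivial, fun A M a => by simp [FOSat, hp]⟩

theorem QFDef.all {σ : Type} {ar : σ → ℕ} {W : Type} (w : W) {ι : Type} [Finite ι]
    {P : ι → ∀ A : Type, DepStr σ ar A → (W → A) → Prop} (h : ∀ i, QFDef ar W (P i)) :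
    QFDef ar W (fun A M a => ∀ i, P i A M a) := by
  classical
  have := Fintype.ofFinite ι
  have key : ∀ s : Finset ι, QFDef ar W (fun A M a => ∀ i ∈ s, P i A M a) := by
    intro s
    induction s using Finset.induction_on with
    | empty => exact (QFDef.const w True).congr fun A M a => by simp
    | insert i s _ ih => exact ((h i).conj ih).congr fun A M a => by simp
  exact (key Finset.univ).congr fun A M a => by simp

theorem QFDef.exi {σ : Type} {ar : σ → ℕ} {W : Type} (w : W) {ι : Type} [Finite ι]
    {P : ι → ∀ A : Type, DepStr σ ar A → (W → A) → Prop} (h : ∀ i, QFDef ar W (P i)) :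
    QFDef ar W (fun A M a => ∃ i, P i A M a) :=
  (QFDef.all w fun i => (h i).neg).neg.congr fun A M a => by simp

/-- Forget the fresh relation. -/
def reductR {σ : Type} {ar : σ → ℕ} {A : Type} {n : ℕ} (M : DepStr (σ ⊕ Unit) (exAr ar n) A) :
    DepStr σ ar A := ⟨fun r v => M.rel (.inl r) v⟩

/-- Satisfaction of a quantifier-free formula by a team given by finitely many
tuples of variables is quantifier-free definable. -/
theorem qf_def {σ : Type} {ar : σ → ℕ} {n : ℕ} {W : Type} (w : W) {k : ℕ} {V : Type}
    (φ : DepFormula σ ar V) : DepFormula.isQF V φ → ∀ (x : Fin k → V → W) (I : Set (Fin k)),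
      QFDef (exAr ar n) W (fun A M a =>
        DepSat (reductR M) V φ ((fun i v => a (x i v)) '' I)) := by
  induction φ with
  | rel r ts =>
    intro _ x I
    refine (QFDef.all w fun i : Fin k => (QFDef.const w (i ∈ I)).imp
      (Q := fun A M a => M.rel (.inl r) fun j => a (x i (ts j)))
      ⟨.rel (.inl r) fun j => x i (ts j), by exact trivial, fun A M a => Iff.rfl⟩).congr fun A M a => ?_
    simp only [DepSat, reductR, Set.forall_mem_image]
    exact Iff.rfl
  | nrel r ts =>
    intro _ x I
    refine (QFDef.all w fun i : Fin k => (QFDef.const w (i ∈ I)).imp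
      (Q := fun A M a => ¬ M.rel (.inl r) fun j => a (x i (ts j)))
      ⟨.not (.rel (.inl r) fun j => x i (ts j)), by exact trivial, fun A M a => Iff.rfl⟩).congr
        fun A M a => ?_
    simp only [DepSat, reductR, Set.forall_mem_image]
    exact Iff.rfl
  | eq y z =>
    intro _ x I
    refine (QFDef.all w fun i : Fin k => (QFDef.const w (i ∈ I)).imp
      (Q := fun A M a => a (x i y) = a (x i z))
      ⟨.eq (x i y) (x i z), by exact trivial, fun A M a => Iff.rfl⟩).congr fun A M a => ?_
    simp [DepSat]
  | neq y z =>
    intro _ x I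
    refine (QFDef.all w fun i : Fin k => (QFDef.const w (i ∈ I)).imp
      (Q := fun A M a => ¬ a (x i y) = a (x i z))
      ⟨.not (.eq (x i y) (x i z)), by exact trivial, fun A M a => Iff.rfl⟩).congr fun A M a => ?_
    simp [DepSat]
  | dep m ys z =>
    intro _ x I
    have e : ∀ u v : W, QFDef (exAr ar n) W (fun A M a => a u = a v) :=
      fun u v => ⟨.eq u v, trivial, fun A M a => Iff.rfl⟩
    refine (QFDef.all w fun i : Fin k => QFDef.all w fun j : Fin k =>
      (QFDef.const w (i ∈ I ∧ j ∈ I)).imp ((QFDef.all w fun l : Fin m =>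
        e (x i (ys l)) (x j (ys l))).imp (e (x i z) (x j z)))).congr fun A M a => ?_
    simp only [DepSat, Set.forall_mem_image]
    constructor
    · intro h i hi j hj; exact h i j ⟨hi, hj⟩
    · intro h i j hij; exact h hij.1 hij.2
  | and φ ψ ih1 ih2 =>
    intro q x I
    exact (ih1 q.1 x I).conj (ih2 q.2 x I)
  | or φ ψ ih1 ih2 =>
    intro q x I
    refine (QFDef.exi w fun p : Set (Fin k) × Set (Fin k) =>
      (QFDef.const w (I = p.1 ∪ p.2)).conj
        ((ih1 q.1 x p.1).conj (ih2 q.2 x p.2))).congr fun A M a => ?_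
    constructor
    · rintro ⟨⟨I₁, I₂⟩, hI, h1, h2⟩
      refine ⟨_, _, ?_, h1, h2⟩
      simp only at hI
      rw [hI, Set.image_union]
    · rintro ⟨T₁, T₂, hT, h1, h2⟩
      have e1 : (fun i v => a (x i v)) '' (I ∩ (fun i v => a (x i v)) ⁻¹' T₁) = T₁ := by
        rw [Set.image_inter_preimage, hT]; simp
      have e2 : (fun i v => a (x i v)) '' (I ∩ (fun i v => a (x i v)) ⁻¹' T₂) = T₂ := by
        rw [Set.image_inter_preimage, hT]; simp
      refine ⟨(I ∩ (fun i v => a (x i v)) ⁻¹' T₁, I ∩ (fun i v => a (x i v)) ⁻¹' T₂), ?_, ?_, ?_⟩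
      · simp only
        rw [← Set.inter_union_distrib_left, ← Set.preimage_union, ← hT]
        exact (Set.inter_eq_left.2 (Set.subset_preimage_image _ _)).symm
      · simp only; rw [e1]; exact h1
      · simp only; rw [e2]; exact h2
  | all φ ih => intro q; exact q.elim
  | ex φ ih => intro q; exact q.elim

/-! Universal closure. -/

theorem allIter_sat {σ : Type} {ar : σ → ℕ} {A : Type} (M : DepStr σ ar A) (l : ℕ) :
    ∀ (θ : FOForm σ ar (OptIter l Empty)),
      FOTrue M (FOForm.allIter l θ) ↔ ∀ s : OptIter l Empty → A, FOSat M _ θ s := by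
  induction l with
  | zero =>
    intro θ
    constructor
    · intro h s
      have : s = (fun e : Empty => e.elim) := funext fun e => Empty.elim e
      rw [this]; exact h
    · intro h; exact h _
  | succ l ih =>
    intro θ
    refine (ih (.all θ)).trans ?_
    constructor
    · intro h s
      have := h (fun v => s (some v)) (s none)
      have e : s = fun o => Option.elim o (s none) fun v => s (some v) := by
        funext o
        cases o <;> rfl
      rw [e]
      exact this
    · intro h s a
      exact h _

theorem allIter_univ {σ : Type} {ar : σ → ℕ} (l : ℕ) :
    ∀ (θ : FOForm σ ar (OptIter l Empty)), θ.IsUniversal → (FOForm.allIter l θ).IsUniversal := by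
  induction l with
  | zero => intro θ h; exact h
  | succ l ih => intro θ h; exact ih _ (.all _ h)

theorem optIter_equiv (l : ℕ) : Nonempty (OptIter l Empty ≃ Fin l) := by
  induction l with
  | zero => exact ⟨Equiv.equivOfIsEmpty Empty (Fin 0)⟩
  | succ l ih =>
    obtain ⟨e⟩ := ih
    exact ⟨(Equiv.optionCongr e).trans (finSuccEquiv l).symm⟩

theorem chi_exists {σ : Type} {ar : σ → ℕ} {n : ℕ}
    (φ : DepFormula σ ar (Fin n)) (hqf : DepFormula.isQF (Fin n) φ) (k : ℕ) :
    ∃ χ : FOForm (σ ⊕ Unit) (exAr ar n) Empty, χ.IsUniversal ∧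
      ∀ (A : Type) [Nonempty A] (M : DepStr σ ar A) (T : Set (Fin n → A)),
        FOTrue (expandR M T) χ ↔
          ∀ f : Fin k → Fin n → A, (∀ i, f i ∈ T) → DepSat M (Fin n) φ (Set.range f) := by
  obtain ⟨e⟩ := optIter_equiv (Fintype.card (Option (Fin k × Fin n)))
  have e' := e.trans (Fintype.equivFin (Option (Fin k × Fin n))).symm
  generalize Fintype.card (Option (Fin k × Fin n)) = l at e'
  let w := e'.symm none
  let x : Fin k → Fin n → OptIter l Empty := fun i v => e'.symm (some (i, v))
  have hd := (QFDef.all w fun i : Fin k => (⟨.rel (.inr ()) fun j => x i j, trivial,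
    fun A M a => Iff.rfl⟩ : QFDef (exAr ar n) _
      fun A M a => M.rel (.inr ()) fun j => a (x i j))).imp (qf_def w φ hqf x Set.univ)
  obtain ⟨θ, q, hθ⟩ := hd
  refine ⟨FOForm.allIter l θ, allIter_univ l θ (.of_qf _ q), ?_⟩
  intro A _ M T
  rw [allIter_sat]
  simp only [hθ, Set.image_univ]
  constructor
  · intro h f hf
    have := h (fun u => match e' u with
      | none => Classical.arbitrary A
      | some p => f p.1 p.2)
    simp only [x, Equiv.apply_symm_apply] at this
    exact this hf
  · intro h a ha
    exact h (fun i j => a (x i j)) ha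

theorem sub_iff {σ : Type} {ar : σ → ℕ} {n : ℕ}
    (φ : DepFormula σ ar (Fin n)) (hqf : DepFormula.isQF (Fin n) φ) (k : ℕ)
    (A : Type) (M : DepStr σ ar A) (T : Set (Fin n → A)) :
    (∀ f : Fin k → Fin n → A, (∀ i, f i ∈ T) → DepSat M (Fin n) φ (Set.range f)) ↔
      ∀ S ⊆ T, S.Finite → S.ncard ≤ k → DepSat M (Fin n) φ S := by
  constructor
  · intro h S hS hfin hc
    rcases S.eq_empty_or_nonempty with rfl | hne
    · exact qf_empty M φ hqf
    · have := hfin.fintype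
      have : Nonempty S := hne.to_subtype
      have hc' : Fintype.card S ≤ Fintype.card (Fin k) := by
        rw [Fintype.card_fin, ← Nat.card_eq_fintype_card]; exact hc
      obtain ⟨g⟩ := Function.Embedding.nonempty_of_card_le hc'
      have hs := Function.invFun_surjective g.injective
      have := h (fun i => (Function.invFun g i).1) fun i => hS (Subtype.prop _)
      have e : Set.range (fun i => (Function.invFun g i).1) = S := by
        change Set.range (Subtype.val ∘ Function.invFun g) = S
        rw [hs.range_comp, Subtype.range_coe]
      rwa [e] at this
  · intro h f hf
    refine h _ (by rintro _ ⟨i, rfl⟩; exact hf i) (Set.finite_range f) ?_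
    have := Set.ncard_image_le (f := f) (Set.finite_univ)
    rw [Set.image_univ, Set.ncard_univ, Nat.card_fin] at this
    exact this

/-! Ultraproducts. -/

/-- Ultraproduct of structures. -/
noncomputable def ultraStr {σ : Type} {ar : σ → ℕ} (U : Ultrafilter ℕ) {A : ℕ → Type}
    (M : ∀ k, DepStr σ ar (A k)) : DepStr σ ar ((U : Filter ℕ).Product A) :=
  ⟨fun r v => ∀ᶠ k in (U : Filter ℕ), (M k).rel r fun i => (v i).out k⟩

/-- The class of a sequence. -/
def umk (U : Ultrafilter ℕ) {A : ℕ → Type} (f : ∀ k, A k) : (U : Filter ℕ).Product A :=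
  Quotient.mk _ f

theorem umk_eq (U : Ultrafilter ℕ) {A : ℕ → Type} (f g : ∀ k, A k) :
    umk U f = umk U g ↔ ∀ᶠ k in (U : Filter ℕ), f k = g k :=
  Quotient.eq

theorem umk_out (U : Ultrafilter ℕ) {A : ℕ → Type} (a : (U : Filter ℕ).Product A) :
    umk U a.out = a := Quotient.out_eq a

theorem los {σ : Type} {ar : σ → ℕ} (U : Ultrafilter ℕ) {A : ℕ → Type} [∀ k, Nonempty (A k)]
    (M : ∀ k, DepStr σ ar (A k)) {V : Type} (θ : FOForm σ ar V) :
    ∀ s : V → ∀ k, A k, FOSat (ultraStr U M) V θ (fun v => umk U (s v)) ↔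
      ∀ᶠ k in (U : Filter ℕ), FOSat (M k) V θ (fun v => s v k) := by
  induction θ with
  | rel r ts =>
    intro s
    have h : ∀ᶠ k in (U : Filter ℕ), ∀ i, (umk U (s (ts i))).out k = s (ts i) k :=
      Filter.eventually_all.2 fun i => (umk_eq U _ _).1 (umk_out U _)
    refine Filter.eventually_congr ?_
    filter_upwards [h] with k hk
    simp only [hk]
    rfl
  | eq x y => intro s; exact umk_eq U _ _
  | not φ ih => intro s; exact (not_congr (ih s)).trans Ultrafilter.eventually_not.symm
  | and φ ψ ih1 ih2 =>
    intro s; exact (and_congr (ih1 s) (ih2 s)).trans Filter.eventually_and.symm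
  | or φ ψ ih1 ih2 =>
    intro s; exact (or_congr (ih1 s) (ih2 s)).trans Ultrafilter.eventually_or.symm
  | @ex V φ ih =>
    intro s
    have key : ∀ f : ∀ k, A k,
        FOSat (ultraStr U M) (Option V) φ (fun o => Option.elim o (umk U f) fun v => umk U (s v)) ↔
        ∀ᶠ k in (U : Filter ℕ),
          FOSat (M k) (Option V) φ (fun o => Option.elim o (f k) fun v => s v k) := by
      intro f
      have := ih (fun o => Option.elim o f s)
      convert this using 2
      · funext o; cases o <;> rfl
      · funext k
        congr 1
        funext o; cases o <;> rfl
    constructor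
    · rintro ⟨a, ha⟩
      rw [← umk_out U a, key] at ha
      filter_upwards [ha] with k hk
      exact ⟨_, hk⟩
    · intro h
      classical
      have : ∀ k, ∃ a : A k, (∃ a : A k, FOSat (M k) (Option V) φ
          (fun o => Option.elim o a fun v => s v k)) →
          FOSat (M k) (Option V) φ (fun o => Option.elim o a fun v => s v k) := by
        intro k
        by_cases hk : ∃ a : A k, FOSat (M k) (Option V) φ
          (fun o => Option.elim o a fun v => s v k)
        · exact ⟨hk.choose, fun _ => hk.choose_spec⟩
        · exact ⟨Classical.arbitrary _, fun h => (hk h).elim⟩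
      choose f hf using this
      refine ⟨umk U f, (key f).2 ?_⟩
      filter_upwards [h] with k hk
      exact hf k hk
  | @all V φ ih =>
    intro s
    have key : ∀ f : ∀ k, A k,
        FOSat (ultraStr U M) (Option V) φ (fun o => Option.elim o (umk U f) fun v => umk U (s v)) ↔
        ∀ᶠ k in (U : Filter ℕ),
          FOSat (M k) (Option V) φ (fun o => Option.elim o (f k) fun v => s v k) := by
      intro f
      have := ih (fun o => Option.elim o f s)
      convert this using 2
      · funext o; cases o <;> rfl
      · funext k
        congr 1
        funext o; cases o <;> rfl
    constructor
    · intro h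
      have : ∀ k, ∃ a : A k, FOSat (M k) (Option V) φ
          (fun o => Option.elim o a fun v => s v k) → ∀ a : A k, FOSat (M k) (Option V) φ
          (fun o => Option.elim o a fun v => s v k) := by
        intro k
        by_contra hc
        push Not at hc
        obtain ⟨_, a, ha⟩ := hc (Classical.arbitrary _)
        exact ha (hc a).1
      choose f hf using this
      filter_upwards [(key f).1 (h _)] with k hk
      exact hf k hk
    · intro h a
      rw [← umk_out U a]
      refine (key _).2 ?_
      filter_upwards [h] with k hk
      exact hk _

theorem los_true {σ : Type} {ar : σ → ℕ} (U : Ultrafilter ℕ) {A : ℕ → Type}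
    [∀ k, Nonempty (A k)] (M : ∀ k, DepStr σ ar (A k)) (θ : FOForm σ ar Empty) :
    FOTrue (ultraStr U M) θ ↔ ∀ᶠ k in (U : Filter ℕ), FOTrue (M k) θ := by
  have := los U M θ (fun e => e.elim)
  have h1 : (fun v : Empty => umk U ((fun e : Empty => (e.elim : ∀ k, A k)) v)) =
    (fun e => e.elim) := funext fun e => e.elim
  have h2 : ∀ k, (fun v : Empty => ((fun e : Empty => (e.elim : ∀ k, A k)) v) k) =
    (fun e => e.elim) := fun k => funext fun e => e.elim
  rw [h1] at this
  simp only [h2] at this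
  exact this

theorem fo_coherent {σ : Type} {ar : σ → ℕ} {n : ℕ}
    (φ : DepFormula σ ar (Fin n)) (hqf : DepFormula.isQF (Fin n) φ) (h : FORewritable φ) :
    Coherent φ := by
  obtain ⟨ψ, hψ⟩ := h
  by_contra hc
  have hk : ∀ k : ℕ, ∃ (A : Type) (_ : Nonempty A) (M : DepStr σ ar A) (T : Set (Fin n → A)),
      ¬ DepSat M (Fin n) φ T ∧
        ∀ S ⊆ T, S.Finite → S.ncard ≤ k + 1 → DepSat M (Fin n) φ S := by
    intro k
    by_contra hcon
    refine hc ⟨k + 1, by omega, ?_⟩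
    intro A hA M T
    constructor
    · intro hT S hS _ _
      exact qf_mono M φ hqf S T hS hT
    · intro hS
      by_contra hT
      exact hcon ⟨A, hA, M, T, hT, hS⟩
  choose A hA M T hT hS using hk
  let U : Ultrafilter ℕ := Filter.hyperfilter ℕ
  let P := ultraStr U M
  let TT : Set (Fin n → (U : Filter ℕ).Product A) :=
    {v | ∀ᶠ k in (U : Filter ℕ), (fun i => (v i).out k) ∈ T k}
  have hP : expandR P TT = ultraStr U (fun k => expandR (M k) (T k)) := by
    unfold expandR ultraStr
    congr 1
    funext r
    cases r <;> rfl
  have : Nonempty ((U : Filter ℕ).Product A) := ⟨umk U fun k => Classical.arbitrary _⟩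
  have hno : ¬ DepSat P (Fin n) φ TT := by
    rw [hψ, hP, los_true]
    intro hev
    obtain ⟨k, hk⟩ := hev.exists
    exact hT k ((hψ _ _ _).2 hk)
  apply hno
  refine qf_compact P φ hqf TT fun S hST => ?_
  obtain ⟨χ, -, hχ⟩ := chi_exists φ hqf S.card
  have : FOTrue (expandR P TT) χ := by
    rw [hP, los_true]
    have hge : ∀ᶠ k in (U : Filter ℕ), S.card ≤ k := by
      have : (U : Filter ℕ) ≤ Filter.atTop := by
        rw [← Nat.cofinite_eq_atTop]; exact Filter.hyperfilter_le_cofinite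
      exact this (Filter.eventually_ge_atTop _)
    filter_upwards [hge] with k hk
    rw [hχ, sub_iff φ hqf]
    intro S' h1 h2 h3
    exact hS k S' h1 h2 (by omega)
  rw [hχ, sub_iff φ hqf] at this
  exact this S hST S.finite_toSet (by simp)

/-- For a quantifier-free dependence formula `φ(x₁,…,xₙ)` the
following are equivalent: (1) `φ` is coherent; (2) `φ` is rewritable to a universal
first-order sentence; (3) `φ` is first-order rewritable. -/
theorem stmt4 {σ : Type} {ar : σ → ℕ} {n : ℕ}
    (φ : DepFormula σ ar (Fin n)) (hqf : DepFormula.isQF (Fin n) φ) :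
    (Coherent φ ↔ UnivRewritable φ) ∧ (UnivRewritable φ ↔ FORewritable φ) := by
  have h12 : Coherent φ → UnivRewritable φ := by
    rintro ⟨k, _, hk⟩
    obtain ⟨χ, hu, hχ⟩ := chi_exists φ hqf k
    refine ⟨χ, hu, fun A _ M T => ?_⟩
    rw [hχ, sub_iff φ hqf]
    exact hk A M T
  have h23 : UnivRewritable φ → FORewritable φ := fun ⟨ψ, _, h⟩ => ⟨ψ, h⟩
  have h31 := fo_coherent φ hqf
  exact ⟨⟨h12, fun h => h31 (h23 h)⟩, ⟨h23, fun h => h12 (h31 h)⟩⟩
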